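/- Let J : {∗} → Δ¹ be the functor sending ∗ to 0, and let F : G → H be any functor injective on objects. Then the pushout product F □ J : H ⊔_G (G × Δ¹) → H × Δ¹ is injective on objects, fully faithful, and essentially surjective; hence it is an acyclic cofibration in the canonical model structure on Grpd. -/

import Mathlib

/-!
STATEMENT 4: For `J : {∗} → Δ¹` sending `∗` to `0` and `F : G ⟶ H` injective on
objects, the pushout product `F □ J : H ⊔_G (G × Δ¹) ⟶ H × Δ¹` is injective on
objects, fully faithful and essentially surjective, hence an acyclic cofibration
in the canonical model structure on `Grpd`.
-/

open CategoryTheory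

universe u

namespace Stmt4

/-- The interval groupoid `Δ¹`. -/
def Interval : Type u := ULift Bool

instance : Groupoid.{u} Interval.{u} where
  Hom _ _ := PUnit
  id _ := ⟨⟩
  comp _ _ := ⟨⟩
  inv _ := ⟨⟩

/-- The object `0` of `Δ¹`. -/
def Interval.zero : Interval.{u} := ⟨false⟩

/-- Regard a functor between groupoids as a morphism in `Grpd`. -/
def homOf {C D : Type u} [Groupoid.{u} C] [Groupoid.{u} D] (F : C ⥤ D) :
    Grpd.of C ⟶ Grpd.of D := F

/-- The arrow category of a groupoid is a groupoid. -/
noncomputable abbrev arrowGroupoid (C : Type u) [Groupoid.{u} C] : Groupoid.{u} (Arrow C) :=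
  Groupoid.ofIsIso fun f => Arrow.isIso_of_isIso_left_of_isIso_right f

/-- The functor sending an object to its identity arrow. -/
def idArrow (C : Type u) [Category.{u} C] : C ⥤ Arrow C where
  obj X := Arrow.mk (𝟙 X)
  map f := Arrow.homMk f f

theorem idArrow_mapArrow {C D : Type u} [Category.{u} C] [Category.{u} D] (K : C ⥤ D) :
    idArrow C ⋙ K.mapArrow = K ⋙ idArrow D := by
  refine Functor.hext (fun X => congrArg Arrow.mk (K.map_id X)) fun X Y f => ?_
  have key : ∀ (i : K.obj X ⟶ K.obj X) (j : K.obj Y ⟶ K.obj Y)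
      (w : K.map f ≫ j = i ≫ K.map f), i = 𝟙 _ → j = 𝟙 _ →
      (Arrow.homMk (K.map f) (K.map f) w : Arrow.mk i ⟶ Arrow.mk j) ≍
        (idArrow D).map (K.map f) := by
    rintro _ _ _ rfl rfl
    rfl
  exact key _ _
    (show K.map f ≫ K.map (𝟙 Y) = K.map (𝟙 X) ≫ K.map f by simp) (K.map_id X) (K.map_id Y)

/-- The functor sending `(x, i)` to the canonical arrow `(x, 0) ⟶ (x, i)`. -/
def contractionArrow (C : Type u) [Groupoid.{u} C] :
    C × Interval.{u} ⥤ Arrow (C × Interval.{u}) where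
  obj p := Arrow.mk (Y := p) (show (p.1, Interval.zero) ⟶ p from (𝟙 p.1, PUnit.unit))
  map f := Arrow.homMk (f.1, PUnit.unit) f (by
    ext
    · simp
    · rfl)

section Pushout

variable {G H P : Grpd.{u, u}} {F : ↑G ⥤ ↑H} {inl : ↑H ⥤ ↑P} {inr : ↑G × Interval.{u} ⥤ ↑P}

theorem pushout_obj_cases
    (hpo : IsPushout (C := Grpd.{u, u}) (Y := Grpd.of (↑G × Interval.{u})) (show G ⟶ H from F)
      (Prod.sectL ↑G Interval.zero.{u}) inl inr) (p : P) :
    (∃ y, inl.obj y = p) ∨ ∃ z, inr.obj z = p := by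
  classical
  let χ (S : P → Prop) : P ⥤ Interval.{u} :=
    { obj := fun p => ⟨decide (S p)⟩
      map := fun _ => PUnit.unit }
  let S (p : P) : Prop := (∃ y, inl.obj y = p) ∨ ∃ z, inr.obj z = p
  have h : χ S = χ fun _ => True := by
    refine hpo.hom_ext (W := Grpd.of Interval.{u}) ?_ ?_
    · refine Functor.hext (fun y => ?_) fun _ _ _ => HEq.rfl
      exact congrArg ULift.up (decide_eq_decide.2 (iff_true_intro (Or.inl ⟨y, rfl⟩)))
    · refine Functor.hext (fun z => ?_) fun _ _ _ => HEq.rfl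
      exact congrArg ULift.up (decide_eq_decide.2 (iff_true_intro (Or.inr ⟨z, rfl⟩)))
  exact (decide_eq_decide.1 (ULift.up.inj (Functor.congr_obj h p))).2 trivial

/-- A retraction `c` of `inl` that extends `F ∘ fst` is inverse to `inl` up to isomorphism. -/
theorem nonempty_iso_id_of_retraction
    (hpo : IsPushout (C := Grpd.{u, u}) (Y := Grpd.of (↑G × Interval.{u})) (show G ⟶ H from F)
      (Prod.sectL ↑G Interval.zero.{u}) inl inr)
    (c : ↑P ⥤ ↑H) (hcl : inl ⋙ c = 𝟭 _) (hcr : inr ⋙ c = CategoryTheory.Prod.fst _ _ ⋙ F) :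
    Nonempty (c ⋙ inl ≅ 𝟭 ↑P) := by
  have hw : F ⋙ inl = Prod.sectL ↑G Interval.zero.{u} ⋙ inr := hpo.w
  let := arrowGroupoid ↑P
  have hcomm : F ⋙ inl ⋙ idArrow ↑P =
      Prod.sectL ↑G Interval.zero.{u} ⋙ contractionArrow ↑G ⋙ inr.mapArrow := by
    calc F ⋙ inl ⋙ idArrow ↑P
        = Prod.sectL ↑G Interval.zero.{u} ⋙ inr ⋙ idArrow ↑P := congrArg (· ⋙ idArrow ↑P) hw
      _ = Prod.sectL ↑G Interval.zero.{u} ⋙ idArrow _ ⋙ inr.mapArrow := by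
        rw [idArrow_mapArrow]
      _ = _ := rfl
  obtain ⟨D, hDl, hDr⟩ : ∃ D : ↑P ⥤ Arrow ↑P,
      inl ⋙ D = inl ⋙ idArrow ↑P ∧ inr ⋙ D = contractionArrow ↑G ⋙ inr.mapArrow :=
    ⟨hpo.desc (W := Grpd.of (Arrow ↑P)) _ _ hcomm, hpo.inl_desc (W := Grpd.of (Arrow ↑P)) _ _ hcomm,
      hpo.inr_desc (W := Grpd.of (Arrow ↑P)) _ _ hcomm⟩
  have hright : D ⋙ Arrow.rightFunc = 𝟭 ↑P := by
    refine hpo.hom_ext (W := P) ?_ ?_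
    · exact congrArg (· ⋙ Arrow.rightFunc) hDl
    · exact congrArg (· ⋙ Arrow.rightFunc) hDr
  have hleft : D ⋙ Arrow.leftFunc = c ⋙ inl := by
    refine hpo.hom_ext (W := P) ?_ ?_
    · exact (congrArg (· ⋙ Arrow.leftFunc) hDl).trans (congrArg (· ⋙ inl) hcl).symm
    · refine (congrArg (· ⋙ Arrow.leftFunc) hDr).trans ?_
      refine Eq.trans ?_ (congrArg (· ⋙ inl) hcr).symm
      exact (congrArg (CategoryTheory.Prod.fst ↑G Interval.{u} ⋙ ·) hw).symm
  have : ∀ f : Arrow ↑P, IsIso ((Arrow.leftToRight (C := ↑P)).app f) := fun f =>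
    inferInstanceAs (IsIso f.hom)
  have := NatIso.isIso_of_isIso_app (Arrow.leftToRight (C := ↑P))
  exact ⟨eqToIso hleft.symm ≪≫ Functor.isoWhiskerLeft D (asIso Arrow.leftToRight) ≪≫
    eqToIso hright⟩

end Pushout

/-- **Pushout product with the endpoint inclusion of the interval**: let `F : G ⟶ H`
be a functor injective on objects, and let `P` together with `inl : H ⟶ P`,
`inr : G × Δ¹ ⟶ P` be a pushout of `F` along `x ↦ (x, 0) : G ⟶ G × Δ¹`. Then the
induced functor `q : P ⟶ H × Δ¹` (the pushout product `F □ J`, characterized by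
`inl ≫ q = (y ↦ (y,0))` and `inr ≫ q = F × 𝟭`) is injective on objects, fully
faithful and essentially surjective — an acyclic cofibration. -/
theorem pushoutProduct_with_interval_is_acyclic_cofibration
    (G H : Grpd.{u, u}) (F : ↑G ⥤ ↑H) (hF : Function.Injective F.obj)
    (P : Grpd.{u, u}) (inl : H ⟶ P) (inr : Grpd.of (↑G × Interval.{u}) ⟶ P)
    (hpo : IsPushout (show G ⟶ H from F)
      (show G ⟶ Grpd.of (↑G × Interval.{u}) from Prod.sectL ↑G Interval.zero.{u}) inl inr)
    (q : P ⟶ Grpd.of (↑H × Interval.{u}))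
    (hl : inl ≫ q = (show H ⟶ Grpd.of (↑H × Interval.{u}) from
      Prod.sectL ↑H Interval.zero.{u}))
    (hr : inr ≫ q = homOf (Functor.prod F (𝟭 Interval.{u}))) :
    Function.Injective q.obj ∧ Functor.Full q ∧ Functor.Faithful q ∧ Functor.EssSurj q := by
  have hw : F ⋙ inl = Prod.sectL ↑G Interval.zero.{u} ⋙ inr := hpo.w
  have hl' : inl ⋙ q = Prod.sectL ↑H Interval.zero.{u} := hl
  have hr' : inr ⋙ q = Functor.prod F (𝟭 Interval.{u}) := hr
  have hw0 (x : ↑G) : inl.obj (F.obj x) = inr.obj (x, Interval.zero) := Functor.congr_obj hw x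
  have hl0 (y : ↑H) : q.obj (inl.obj y) = (y, Interval.zero) := Functor.congr_obj hl' y
  have hr0 (z : ↑G × Interval.{u}) : q.obj (inr.obj z) = (F.obj z.1, z.2) :=
    Functor.congr_obj hr' z
  obtain ⟨e⟩ := nonempty_iso_id_of_retraction hpo (q ⋙ CategoryTheory.Prod.fst _ _)
    (congrArg (· ⋙ CategoryTheory.Prod.fst _ _) hl') (congrArg (· ⋙ CategoryTheory.Prod.fst _ _) hr')
  have hinl : Functor.EssSurj inl := ⟨fun p => ⟨_, ⟨e.app p⟩⟩⟩
  have hff : (Prod.sectL ↑H Interval.zero.{u}).FullyFaithful :=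
    { preimage := fun f => f.1 }
  refine ⟨?_, ⟨fun {p p'} f => ?_⟩, ?_, ⟨fun z => ?_⟩⟩
  · have hmixed (y : ↑H) (z : ↑G × Interval.{u})
        (h : q.obj (inl.obj y) = q.obj (inr.obj z)) : inl.obj y = inr.obj z := by
      obtain ⟨x, i⟩ := z
      rw [hl0, hr0] at h
      obtain ⟨rfl, rfl⟩ := Prod.mk.inj h
      exact hw0 x
    intro p p' h
    rcases pushout_obj_cases hpo p with ⟨y, rfl⟩ | ⟨z, rfl⟩ <;>
      rcases pushout_obj_cases hpo p' with ⟨y', rfl⟩ | ⟨z', rfl⟩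
    · rw [hl0, hl0] at h
      rw [(Prod.mk.inj h).1]
    · exact hmixed y z' h
    · exact (hmixed y' z h.symm).symm
    · rw [hr0, hr0] at h
      obtain ⟨h₁, h₂⟩ := Prod.mk.inj h
      rw [Prod.ext (hF h₁) h₂]
  · have : (inl ⋙ q).Full := by
      rw [hl']
      exact hff.full
    let θ := inl.objObjPreimageIso p
    let θ' := inl.objObjPreimageIso p'
    obtain ⟨h, hh⟩ := (inl ⋙ q).map_surjective (q.map θ.hom ≫ f ≫ q.map θ'.inv)
    refine ⟨θ.inv ≫ inl.map h ≫ θ'.hom, ?_⟩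
    rw [Functor.comp_map] at hh
    rw [q.map_comp, q.map_comp, hh, Category.assoc, Category.assoc, ← q.map_comp θ'.inv,
      θ'.inv_hom_id, q.map_id, Category.comp_id, ← q.map_comp_assoc, θ.inv_hom_id, q.map_id,
      Category.id_comp]
  · have : ((q ⋙ CategoryTheory.Prod.fst _ _) ⋙ inl).Faithful := Functor.Faithful.of_iso e.symm
    have : (q ⋙ CategoryTheory.Prod.fst _ _).Faithful := Functor.Faithful.of_comp _ inl
    exact Functor.Faithful.of_comp q (CategoryTheory.Prod.fst _ _)
  · exact ⟨inl.obj z.1, ⟨eqToIso (hl0 z.1) ≪≫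
      (Groupoid.isoEquivHom (C := ↑H × Interval.{u}) (z.1, Interval.zero) z).symm
        (𝟙 z.1, PUnit.unit)⟩⟩

end Stmt4
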